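/- arXiv:1703.10013 — 2 statements merged into one kernel-verified Lean document; each statement's English description precedes it below -/
import Mathlib

section
/- Let G be a finitely generated group and A a finite alphabet with at least one element. If X ⊆ A^G is a subshift (closed, shift-invariant subset) such that every x ∈ X has a finite G-orbit under the shift action, then X is finite. -/
open scoped Pointwise

theorem Group.FG.exists_finite_forall_mem_pow (H : Type*) [Group H] [Group.FG H] :
    ∃ S : Set H, S.Finite ∧ 1 ∈ S ∧ ∀ h : H, ∃ n : ℕ, h ∈ S ^ n := by
  obtain ⟨T, hT, hfin⟩ := Monoid.fg_iff.1 (Group.fg_iff_monoid_fg.1 ‹Group.FG H›)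
  refine ⟨insert 1 T, hfin.insert 1, Set.mem_insert _ _, fun h => ?_⟩
  have hh : h ∈ Submonoid.closure T := hT ▸ Submonoid.mem_top h
  induction hh using Submonoid.closure_induction with
  | mem x hx => exact ⟨1, by simp [hx]⟩
  | one => exact ⟨0, by simp⟩
  | mul x y _ _ hx hy =>
    obtain ⟨m, hm⟩ := hx
    obtain ⟨n, hn⟩ := hy
    exact ⟨m + n, by rw [pow_add]; exact Set.mul_mem_mul hm hn⟩

/-- If all orbits of a finitely generated group acting on a compact space are finite, then whether
an orbit stays in a clopen set is decided by finitely many group elements. -/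
theorem IsClopen.exists_finite_forall_smul_mem {H Y : Type*} [Group H] [Group.FG H]
    [TopologicalSpace Y] [CompactSpace Y] [MulAction H Y] [ContinuousConstSMul H Y]
    (horb : ∀ y : Y, (MulAction.orbit H y).Finite) {U : Set Y} (hU : IsClopen U) :
    ∃ B : Set H, B.Finite ∧ ∀ z : Y, (∀ b ∈ B, b • z ∈ U) → ∀ h : H, h • z ∈ U := by
  classical
  obtain ⟨S, hSfin, hS1, hS⟩ := Group.FG.exists_finite_forall_mem_pow H
  have hpow : ∀ n : ℕ, (S ^ n).Finite := by
    intro n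
    induction n with
    | zero => simp
    | succ n ih => rw [pow_succ]; exact ih.mul hSfin
  have hmono : ∀ {m n : ℕ}, m ≤ n → S ^ m ⊆ S ^ n := fun h => Set.pow_subset_pow_right hS1 h
  by_contra! hcon
  let E : ℕ → Set Y := fun j =>
    Uᶜ ∩ ⋃ p ∈ S ^ (j + 1), ⋂ b ∈ S ^ j, (fun y => (b * p⁻¹) • y) ⁻¹' U
  have hE : ∀ j, IsClosed (E j) := fun j =>
    hU.compl.isClosed.inter <| (hpow _).isClosed_biUnion fun p _ =>
      isClosed_biInter fun b _ => hU.isClosed.preimage (continuous_const_smul _)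
  have hne : ∀ k, (⋂ j ≤ k, E j).Nonempty := by
    intro k
    obtain ⟨z, hz, h₀, hh₀⟩ := hcon (S ^ k) (hpow k)
    have hex : ∃ n, ∃ h ∈ S ^ n, h • z ∉ U := by
      obtain ⟨n, hn⟩ := hS h₀
      exact ⟨n, h₀, hn, hh₀⟩
    obtain ⟨h, hh, hhU⟩ := Nat.find_spec hex
    have hmin : ∀ m < Nat.find hex, ∀ g ∈ S ^ m, g • z ∈ U := by
      intro m hm g hg
      by_contra hgU
      exact Nat.find_min hex hm ⟨g, hg, hgU⟩
    have hk : k < Nat.find hex := by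
      by_contra! hle
      exact hhU (hz h (hmono hle hh))
    refine ⟨h • z, Set.mem_iInter₂.2 fun j hj => ⟨hhU, ?_⟩⟩
    obtain ⟨l, hl⟩ := Nat.exists_eq_add_of_le (show j + 1 ≤ Nat.find hex by omega)
    rw [hl, pow_add] at hh
    obtain ⟨p, hp, q, hq, rfl⟩ := Set.mem_mul.1 hh
    refine Set.mem_iUnion₂.2 ⟨p, hp, Set.mem_iInter₂.2 fun b hb => ?_⟩
    have hbq : (b * q) • z ∈ U :=
      hmin (j + l) (by omega) _ (by rw [pow_add]; exact Set.mul_mem_mul hb hq)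
    simpa [smul_smul, mul_assoc] using hbq
  obtain ⟨y, hy⟩ := IsCompact.nonempty_iInter_of_sequence_nonempty_isCompact_isClosed
    (fun k => ⋂ j ≤ k, E j)
    (fun k => Set.biInter_mono (fun j (hj : j ≤ k) => Nat.le_succ_of_le hj) fun _ _ => subset_rfl)
    hne (isClosed_biInter fun j _ => hE j).isCompact (fun k => isClosed_biInter fun j _ => hE j)
  have hyE : ∀ j, y ∈ E j := fun j => Set.mem_iInter₂.1 (Set.mem_iInter.1 hy j) j le_rfl
  have hret : ∀ w ∈ MulAction.orbit H y, ∃ n, ∃ b ∈ S ^ n, b • w = y := by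
    rintro _ ⟨g, rfl⟩
    obtain ⟨n, hn⟩ := hS g⁻¹
    exact ⟨n, g⁻¹, hn, inv_smul_smul g y⟩
  choose! n hn using hret
  obtain ⟨N, hN⟩ := ((horb y).image n).bddAbove
  obtain ⟨hyU, hyN⟩ := hyE N
  obtain ⟨p, -, hp⟩ := Set.mem_iUnion₂.1 hyN
  have hw : p⁻¹ • y ∈ MulAction.orbit H y := ⟨p⁻¹, rfl⟩
  obtain ⟨b, hb, hby⟩ := hn _ hw
  have hbU : (b * p⁻¹) • y ∈ U :=
    Set.mem_iInter₂.1 hp b (hmono (hN (Set.mem_image_of_mem n hw)) hb)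
  rw [mul_smul, hby] at hbU
  exact hyU hbU

theorem MulAction.finiteIndex_stabilizer_of_finite_orbit {G Y : Type*} [Group G] [MulAction G Y] {x : Y}
    (hx : (orbit G x).Finite) : (stabilizer G x).FiniteIndex := by
  have := hx.to_subtype
  have : Finite (G ⧸ stabilizer G x) := Finite.of_equiv _ (orbitEquivQuotientStabilizer G x)
  exact Subgroup.finiteIndex_of_finite_quotient

/-- A compact space with an expansive action of a finitely generated group all of whose orbits are
finite is finite. -/
theorem finite_of_finite_orbits_of_expansive {G Y : Type*} [Group G] [Group.FG G]
    [TopologicalSpace Y] [CompactSpace Y] [MulAction G Y] [ContinuousConstSMul G Y]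
    (horb : ∀ y : Y, (MulAction.orbit G y).Finite)
    (hexp : ∀ x : Y, ∃ U : Set Y, IsClopen U ∧ x ∈ U ∧
      ∀ z, (∀ h ∈ MulAction.stabilizer G x, h • z ∈ U) → z = x) :
    Finite Y := by
  suffices DiscreteTopology Y from finite_of_compact_of_discrete
  refine discreteTopology_iff_isOpen_singleton.2 fun x => ?_
  obtain ⟨U, hU, hxU, hx⟩ := hexp x
  have := MulAction.finiteIndex_stabilizer_of_finite_orbit (horb x)
  have : ContinuousConstSMul (MulAction.stabilizer G x) Y :=
    ⟨fun h => continuous_const_smul (h : G)⟩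
  obtain ⟨B, hB, hBU⟩ := hU.exists_finite_forall_smul_mem (H := MulAction.stabilizer G x)
    fun y => (horb y).subset (by rintro _ ⟨g, rfl⟩; exact ⟨g, rfl⟩)
  have hV : IsOpen (⋂ b ∈ B, (fun y : Y => b • y) ⁻¹' U) :=
    hB.isOpen_biInter fun b _ => hU.isOpen.preimage (continuous_const_smul b)
  convert hV
  ext z
  simp only [Set.mem_singleton_iff, Set.mem_iInter, Set.mem_preimage]
  constructor
  · rintro rfl b -
    rwa [show b • z = z from b.2]
  · exact fun hz => hx z fun h hh => hBU z hz ⟨h, hh⟩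

theorem stmt_6 {G A : Type*} [Group G] [Group.FG G] [Finite A] [Nonempty A]
    [TopologicalSpace A] [DiscreteTopology A]
    (X : Set (G → A)) (hclosed : IsClosed X)
    (hinv : ∀ x ∈ X, ∀ g : G, (fun h : G => x (g⁻¹ * h)) ∈ X)
    (horb : ∀ x ∈ X, {y : G → A | ∃ g : G, y = fun h : G => x (g⁻¹ * h)}.Finite) :
    X.Finite := by
  let _ : MulAction G X :=
    { smul := fun g x => ⟨fun h => x.1 (g⁻¹ * h), hinv x.1 x.2 g⟩
      one_smul := fun x => Subtype.ext <| funext fun h =>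
        congrArg x.1 (show (1 : G)⁻¹ * h = h by simp)
      mul_smul := fun a b x => Subtype.ext <| funext fun h =>
        congrArg x.1 (show (a * b)⁻¹ * h = b⁻¹ * (a⁻¹ * h) by simp [mul_assoc]) }
  have hsmul : ∀ (g : G) (x : X) (h : G), (g • x).1 h = x.1 (g⁻¹ * h) := fun _ _ _ => rfl
  have : ContinuousConstSMul G X :=
    ⟨fun g => continuous_induced_rng.2 <|
      continuous_pi fun h => (continuous_apply (g⁻¹ * h)).comp continuous_subtype_val⟩
  have : CompactSpace X := isCompact_iff_compactSpace.1 hclosed.isCompact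
  have horbX : ∀ x : X, (MulAction.orbit G x).Finite := fun x =>
    Set.Finite.of_finite_image
      ((horb x.1 x.2).subset (by rintro _ ⟨_, ⟨g, rfl⟩, rfl⟩; exact ⟨g, rfl⟩))
      Subtype.val_injective.injOn
  have : Finite X := by
    refine finite_of_finite_orbits_of_expansive (G := G) horbX fun x => ?_
    have := MulAction.finiteIndex_stabilizer_of_finite_orbit (horbX x)
    let t : G ⧸ MulAction.stabilizer G x → G := fun q => q.out⁻¹
    refine ⟨⋂ q, {z : X | z.1 (t q) = x.1 (t q)}, ?_, by simp, fun z hz => ?_⟩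
    · refine isClopen_iInter_of_finite fun q => ?_
      exact (isClopen_discrete {x.1 (t q)}).preimage
        ((continuous_apply (t q)).comp continuous_subtype_val)
    · refine Subtype.ext (funext fun g => ?_)
      have hg : g * (QuotientGroup.mk g⁻¹ : G ⧸ MulAction.stabilizer G x).out ∈
          MulAction.stabilizer G x := by
        have := QuotientGroup.eq.1
          (QuotientGroup.out_eq' (QuotientGroup.mk g⁻¹ : G ⧸ MulAction.stabilizer G x)).symm
        simpa using this
      set o := (QuotientGroup.mk g⁻¹ : G ⧸ MulAction.stabilizer G x).out with ho
      have hk := (MulAction.stabilizer G x).inv_mem hg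
      have hzk : ((g * o)⁻¹ • z).1 o⁻¹ = x.1 o⁻¹ :=
        Set.mem_iInter.1 (hz _ hk) (QuotientGroup.mk g⁻¹)
      have hxk : ((g * o)⁻¹ • x).1 o⁻¹ = x.1 o⁻¹ := by rw [MulAction.mem_stabilizer_iff.1 hk]
      rw [hsmul] at hzk hxk
      simpa using hzk.trans hxk.symm
  exact Set.toFinite X
end

section
/- Let G be a group and M a finitely generated semigroup with commuting actions G ↷ X ↶ M on a compact metric space X. If the G-action is expansive and the M-action is pointwise periodic (every M-orbit finite) and faithful, then M is finite. -/
open scoped Pointwise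

/-- `spow S n` is the set `Sⁿ` of products of `n` elements of `S` (empty for `n = 0`). -/
def spow {M : Type*} [Mul M] (S : Set M) : ℕ → Set M
  | 0 => ∅
  | 1 => S
  | n + 2 => spow S (n + 1) * S

/-- `M` induces only finitely many maps on `Y`. -/
def FiniteOn {M X : Type*} (act : X → M → X) (Y : Set X) : Prop :=
  (Set.range fun (m : M) (y : Y) => act y m).Finite

theorem FiniteOn.exists_rep {M X : Type*} {act : X → M → X} {Y : Set X} (h : FiniteOn act Y) :
    ∃ r : M → M, (Set.range r).Finite ∧ ∀ m, ∀ y ∈ Y, act y (r m) = act y m := by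
  have := h.to_subtype
  let q := Set.rangeFactorization fun (m : M) (y : Y) => act y m
  have hq : Function.Surjective q := Set.rangeFactorization_surjective
  refine ⟨fun m => Function.surjInv hq (q m), ?_, fun m y hy => ?_⟩
  · exact (Set.finite_range (Function.surjInv hq)).subset 
      (Set.range_comp_subset_range q (Function.surjInv hq))
  · exact congrFun (congrArg Subtype.val (Function.surjInv_eq hq (q m))) ⟨y, hy⟩

theorem FiniteOn.of_finset {M X : Type*} {act : X → M → X} {Y : Set X} (F : Finset M)
    (h : ∀ m, ∃ f ∈ F, ∀ y ∈ Y, act y m = act y f) : FiniteOn act Y := by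
  refine (F.finite_toSet.image fun (m : M) (y : Y) => act y m).subset ?_
  rintro _ ⟨m, rfl⟩
  obtain ⟨f, hf, hY⟩ := h m
  exact ⟨f, hf, funext fun y => (hY y y.2).symm⟩

theorem FiniteOn.union {M X : Type*} {act : X → M → X} {Y Z : Set X}
    (hY : FiniteOn act Y) (hZ : FiniteOn act Z) : FiniteOn act (Y ∪ Z) := by
  refine Set.Finite.of_finite_image (f := fun p : ↥(Y ∪ Z) → X =>
    ((fun y : Y => p ⟨y, .inl y.2⟩), fun z : Z => p ⟨z, .inr z.2⟩))
    ((hY.prod hZ).subset ?_) ?_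
  · rintro _ ⟨_, ⟨m, rfl⟩, rfl⟩
    exact ⟨⟨m, rfl⟩, ⟨m, rfl⟩⟩
  · intro p _ q _ h
    rw [Prod.mk.injEq] at h
    funext ⟨x, hx⟩
    rcases hx with hx | hx
    exacts [congrFun h.1 ⟨x, hx⟩, congrFun h.2 ⟨x, hx⟩]

theorem FiniteOn.mono {M X : Type*} {act : X → M → X} {Y Z : Set X}
    (hZ : FiniteOn act Z) (h : Y ⊆ Z) : FiniteOn act Y := by
  obtain ⟨r, hr, hrep⟩ := hZ.exists_rep
  exact .of_finset hr.toFinset fun m => ⟨r m, by simp, fun y hy => (hrep m y (h hy)).symm⟩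

theorem finite_spow {M : Type*} [Mul M] {S : Set M} (hS : S.Finite) (n : ℕ) :
    (spow S n).Finite := by
  induction n with
  | zero => exact Set.finite_empty
  | succ n ih =>
    cases n with
    | zero => exact hS
    | succ n => exact ih.mul hS

theorem FiniteOn.of_closed_under_generators {M X : Type*} [Semigroup M] {act : X → M → X}
    (hact : ∀ (x : X) (m n : M), act (act x m) n = act x (m * n))
    {S : Finset M} (hgen : ∀ m : M, ∃ n : ℕ, m ∈ spow (S : Set M) n) {Y : Set X}
    (F : Finset M) (hSF : S ⊆ F)
    (h : ∀ f ∈ F, ∀ s ∈ S, ∃ f' ∈ F, ∀ y ∈ Y, act y (f * s) = act y f') :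
    FiniteOn act Y := by
  have key : ∀ n, ∀ m ∈ spow (S : Set M) n, ∃ f ∈ F, ∀ y ∈ Y, act y m = act y f := by
    intro n
    induction n with
    | zero => exact fun m hm => hm.elim
    | succ n ih =>
      cases n with
      | zero => exact fun m hm => ⟨m, hSF hm, fun _ _ => rfl⟩
      | succ n =>
        rintro _ ⟨u, hu, s, hs, rfl⟩
        obtain ⟨f, hf, hfu⟩ := ih u hu
        obtain ⟨f', hf', hff⟩ := h f hf s hs
        refine ⟨f', hf', fun y hy => ?_⟩
        rw [← hff y hy, ← hact, ← hact, hfu y hy]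
  exact .of_finset F fun m => (hgen m).elim fun n hn => key n m hn

/-- Near a set on which `M` is finite, `M` remains finite on `G`-invariant sets. -/
theorem FiniteOn.exists_open_nhd {G M X : Type*} [Group G] [Semigroup M] [MetricSpace X]
    [MulAction G X] {act : X → M → X}
    (hact : ∀ (x : X) (m n : M), act (act x m) n = act x (m * n))
    (hcM : ∀ m : M, Continuous fun x : X => act x m)
    (hcomm : ∀ (g : G) (x : X) (m : M), g • act x m = act (g • x) m)
    {S : Finset M} (hgen : ∀ m : M, ∃ n : ℕ, m ∈ spow (S : Set M) n)
    {ε : ℝ} (hε : 0 < ε) (hexp : ∀ x y : X, x ≠ y → ∃ g : G, ε < dist (g • x) (g • y))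
    {Y : Set X} (hY : FiniteOn act Y) :
    ∃ O : Set X, IsOpen O ∧ Y ⊆ O ∧
      ∀ Z ⊆ O, (∀ g : G, ∀ z ∈ Z, g • z ∈ Z) → FiniteOn act Z := by
  classical
  obtain ⟨r, hr, hrep⟩ := hY.exists_rep
  let F := S ∪ hr.toFinset
  refine ⟨⋂ p ∈ F ×ˢ S, {x | dist (act x (p.1 * p.2)) (act x (r (p.1 * p.2))) < ε},
    isOpen_biInter_finset fun p _ => isOpen_lt ((hcM _).dist (hcM _)) continuous_const, ?_, ?_⟩
  · intro y hy
    simp only [Set.mem_iInter, Set.mem_ofPred_eq]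
    intro p _
    rw [hrep _ y hy, dist_self]
    exact hε
  · intro Z hZ hinv
    refine .of_closed_under_generators hact hgen F Finset.subset_union_left fun f hf s hs =>
      ⟨r (f * s), by simp [F], fun z hz => ?_⟩
    by_contra hne
    obtain ⟨g, hg⟩ := hexp _ _ hne
    have hmem := hZ (hinv g z hz)
    simp only [Set.mem_iInter, Set.mem_ofPred_eq] at hmem
    rw [hcomm, hcomm] at hg
    exact lt_asymm hg (hmem (f, s) (Finset.mk_mem_product hf hs))

/-- A point with finite orbit satisfies finitely many equations which force finiteness. -/
theorem exists_finite_relations {M X : Type*} [Semigroup M] {act : X → M → X}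
    (hact : ∀ (x : X) (m n : M), act (act x m) n = act x (m * n))
    {S : Finset M} (hgen : ∀ m : M, ∃ n : ℕ, m ∈ spow (S : Set M) n) {x : X}
    (hx : {y : X | ∃ m : M, act x m = y}.Finite) :
    ∃ R : Finset (M × M), (∀ p ∈ R, act x p.1 = act x p.2) ∧
      FiniteOn act {y | ∀ p ∈ R, act y p.1 = act y p.2} := by
  classical
  have hfin : FiniteOn act {x} := by
    refine (hx.image fun (y : X) (_ : ({x} : Set X)) => y).subset ?_
    rintro _ ⟨m, rfl⟩
    refine ⟨act x m, ⟨m, rfl⟩, ?_⟩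
    funext ⟨y, hy⟩
    obtain rfl := Set.mem_singleton_iff.1 hy
    rfl
  obtain ⟨r, hr, hrep⟩ := hfin.exists_rep
  let F := S ∪ hr.toFinset
  refine ⟨(F ×ˢ S).image fun p => (p.1 * p.2, r (p.1 * p.2)), ?_, ?_⟩
  · intro p hp
    obtain ⟨q, _, rfl⟩ := Finset.mem_image.1 hp
    exact (hrep _ x rfl).symm
  · exact .of_closed_under_generators hact hgen F Finset.subset_union_left fun f hf s hs =>
      ⟨r (f * s), by simp [F], fun y hy =>
        hy _ (Finset.mem_image_of_mem (fun p : M × M => (p.1 * p.2, r (p.1 * p.2)))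
          (Finset.mk_mem_product hf hs))⟩

/-- If `M` is finite on all proper closed invariant subsets of `Z`, then it is finite on `Z`. -/
theorem finiteOn_of_forall_ssubset {G M X : Type*} [Group G] [Semigroup M] [MetricSpace X]
    [CompactSpace X] [MulAction G X] (hcG : ∀ g : G, Continuous fun x : X => g • x)
    {act : X → M → X}
    (hact : ∀ (x : X) (m n : M), act (act x m) n = act x (m * n))
    (hcM : ∀ m : M, Continuous fun x : X => act x m)
    (hcomm : ∀ (g : G) (x : X) (m : M), g • act x m = act (g • x) m)
    {S : Finset M} (hgen : ∀ m : M, ∃ n : ℕ, m ∈ spow (S : Set M) n)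
    (hpp : ∀ x : X, {y : X | ∃ m : M, act x m = y}.Finite)
    {Z : Set X} (hZc : IsClosed Z) (hZ : ∀ g : G, ∀ z ∈ Z, g • z ∈ Z)
    (hmin : ∀ Y ⊂ Z, IsClosed Y → (∀ g : G, ∀ y ∈ Y, g • y ∈ Y) → FiniteOn act Y) :
    FiniteOn act Z := by
  have hM : Countable M := by
    rw [← Set.countable_univ_iff]
    refine (Set.countable_iUnion fun n => (finite_spow S.finite_toSet n).countable).mono
      fun m _ => Set.mem_iUnion.2 (hgen m)
  rcases Z.eq_empty_or_nonempty with rfl | hne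
  · exact Set.toFinite _
  have := hne.to_subtype
  have := isCompact_iff_compactSpace.1 hZc.isCompact
  let E (R : Finset (M × M)) : Set X := {y | ∀ p ∈ R, act y p.1 = act y p.2}
  have hE (R) : IsClosed (E R) := by
    simp only [E, Set.ofPred_forall]
    exact isClosed_iInter fun p => isClosed_iInter fun _ => isClosed_eq (hcM _) (hcM _)
  obtain ⟨⟨R, hR⟩, z, hz⟩ := nonempty_interior_of_iUnion_of_closed
    (f := fun R : {R // FiniteOn act (E R)} => ((↑) : Z → X) ⁻¹' E R)
    (fun R => (hE R).preimage continuous_subtype_val) (Set.eq_univ_of_forall fun z => by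
      obtain ⟨R, hzR, hR⟩ := exists_finite_relations hact hgen (hpp z)
      exact Set.mem_iUnion.2 ⟨⟨R, hR⟩, hzR⟩)
  obtain ⟨V, hVE, hV, hzV⟩ := mem_interior.1 hz
  obtain ⟨U, hU, rfl⟩ := isOpen_induced_iff.1 hV
  have hrest : FiniteOn act {y ∈ Z | ∀ g : G, g • y ∉ U} := by
    refine hmin _ ⟨Set.sep_subset _ _, fun h => (h z.2).2 1 (by simpa using hzV)⟩ ?_ ?_
    · have : IsClosed {y : X | ∀ g : G, g • y ∉ U} := by
        simp only [Set.ofPred_forall]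
        exact isClosed_iInter fun g => (hU.preimage (hcG g)).isClosed_compl
      exact hZc.inter this
    · exact fun g y hy => ⟨hZ g y hy.1, fun h => by simpa [mul_smul] using hy.2 (h * g)⟩
  refine (hR.union hrest).mono fun y hy => ?_
  by_cases h : ∃ g : G, g • y ∈ U
  · obtain ⟨g, hg⟩ := h
    refine .inl fun p hp => MulAction.injective g ?_
    simpa only [hcomm] using hVE (a := ⟨g • y, hZ g y hy⟩) hg p hp
  · exact .inr ⟨hy, not_exists.1 h⟩

theorem stmt_16 {G M X : Type*} [Group G] [Semigroup M] [MetricSpace X] [CompactSpace X]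
    [MulAction G X] (hcG : ∀ g : G, Continuous fun x : X => g • x)
    (act : X → M → X) (hact : ∀ (x : X) (m n : M), act (act x m) n = act x (m * n))
    (hcM : ∀ m : M, Continuous fun x : X => act x m)
    (hcomm : ∀ (g : G) (x : X) (m : M), g • act x m = act (g • x) m)
    (S : Finset M) (hgen : ∀ m : M, ∃ n : ℕ, m ∈ spow (S : Set M) n)
    (hexp : ∃ ε > (0 : ℝ), ∀ x y : X, x ≠ y → ∃ g : G, ε < dist (g • x) (g • y))
    (hpp : ∀ x : X, {y : X | ∃ m : M, act x m = y}.Finite)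
    (hfaith : ∀ m m' : M, (∀ x : X, act x m = act x m') → m = m') :
    Finite M := by
  obtain ⟨ε, hε, hexp⟩ := hexp
  suffices h : FiniteOn act Set.univ by
    refine Finite.of_finite_univ (Set.Finite.of_finite_image
      (f := fun m (y : (Set.univ : Set X)) => act y m) (h.subset (Set.image_subset_range _ _)) ?_)
    exact fun m _ m' _ hm => hfaith m m' fun x => congrFun hm ⟨x, trivial⟩
  by_contra hX
  obtain ⟨Z, -, hZ⟩ : ∃ Z ⊆ Set.univ, Minimal (· ∈ {Y : Set X | IsClosed Y ∧
      (∀ g : G, ∀ y ∈ Y, g • y ∈ Y) ∧ ¬ FiniteOn act Y}) Z := by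
    refine zorn_superset_nonempty _ (fun c hc hchain hne => ?_) Set.univ
      ⟨isClosed_univ, fun _ _ _ => trivial, hX⟩
    refine ⟨⋂₀ c, ⟨isClosed_sInter fun Y hY => (hc hY).1,
      fun g y hy Y hY => (hc hY).2.1 g y (hy Y hY), fun hfin => ?_⟩,
      fun Y hY => Set.sInter_subset_of_mem hY⟩
    obtain ⟨O, hO, hcO, hfinO⟩ := hfin.exists_open_nhd hact hcM hcomm hgen hε hexp
    have := hne.to_subtype
    have hdir : Directed (· ⊇ ·) ((↑) : c → Set X) :=
      DirectedOn.directed_val (IsChain.directedOn hchain.symm)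
    obtain ⟨⟨Y, hY⟩, hYO⟩ := exists_subset_nhds_of_isCompact' (V := ((↑) : c → Set X)) hdir
      (fun Y => (hc Y.2).1.isCompact) (fun Y => (hc Y.2).1)
      (U := O) (fun x hx => hO.mem_nhds (hcO (by rwa [Set.sInter_eq_iInter])))
    exact (hc hY).2.2 (hfinO Y hYO (hc hY).2.1)
  refine hZ.prop.2.2
    (finiteOn_of_forall_ssubset hcG hact hcM hcomm hgen hpp hZ.prop.1 hZ.prop.2.1 ?_)
  intro Y hYZ hYc hY
  by_contra hfin
  exact hYZ.2 (hZ.le_of_le ⟨hYc, hY, hfin⟩ hYZ.1)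
end
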